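/- Let f : ℝ^n → ℝ be continuously differentiable with L-Lipschitz gradient, let P be a real n×m matrix each of whose columns has Euclidean norm at most 1, let H be a symmetric m×m matrix with M₁ I_m ⪯ H ⪯ M₂ I_m (0 < M₁ ≤ M₂), let c ∈ (0, 1/2), ε > 0, and x ∈ ℝ^n. Set g̃ = ∇_{P,ε}f(x) (the finite-difference subspace gradient) and d = −H g̃, and assume ‖g̃‖ ≥ 2 m² L (M₂/(M₁ c)) ε. Then for every step size α with 0 < α ≤ 2(1−2c)/(m M₂ L) the approximate Armijo condition f(x + αPd) ≤ f(x) + cα g̃ᵀ d holds. -/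

import Mathlib

open Matrix
open scoped RealInnerProductSpace

/-- The finite-difference subspace gradient: `(∇_{P,ε}f(x))_i = (f(x+εPe_i) - f(x-εPe_i))/(2ε)`. -/
noncomputable def fdGrad {n m : ℕ} (f : EuclideanSpace ℝ (Fin n) → ℝ)
    (P : Matrix (Fin n) (Fin m) ℝ) (ε : ℝ) (x : EuclideanSpace ℝ (Fin n)) :
    EuclideanSpace ℝ (Fin m) :=
  (EuclideanSpace.equiv (Fin m) ℝ).symm fun i =>
    (f (x + ε • Matrix.toEuclideanLin P (EuclideanSpace.single i (1 : ℝ))) -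
      f (x - ε • Matrix.toEuclideanLin P (EuclideanSpace.single i (1 : ℝ)))) / (2 * ε)

section DescentLemma

variable {E : Type*} [NormedAddCommGroup E] [InnerProductSpace ℝ E] [CompleteSpace E]

/-- The descent lemma for functions with Lipschitz gradient. -/
theorem descent_lemma {f : E → ℝ} {L : ℝ} (hf : Differentiable ℝ f)
    (hlip : ∀ u v : E, ‖gradient f u - gradient f v‖ ≤ L * ‖u - v‖) (x u : E) :
    f (x + u) ≤ f x + ⟪gradient f x, u⟫ + L / 2 * ‖u‖ ^ 2 := by
  set ψ : ℝ → ℝ := fun t => f (x + t • u) - t * ⟪gradient f x, u⟫ - L / 2 * ‖u‖ ^ 2 * t ^ 2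
  have hψ (t : ℝ) : HasDerivAt ψ
      (⟪gradient f (x + t • u), u⟫ - ⟪gradient f x, u⟫ - L * ‖u‖ ^ 2 * t) t := by
    have hline : HasDerivAt (fun t : ℝ => x + t • u) u t := by
      simpa using ((hasDerivAt_id t).smul_const u).const_add x
    have hcomp := (hf (x + t • u)).hasGradientAt.hasFDerivAt.comp_hasDerivAt t hline
    rw [InnerProductSpace.toDual_apply_apply] at hcomp
    have hlin : HasDerivAt (fun t : ℝ => t * ⟪gradient f x, u⟫) ⟪gradient f x, u⟫ t := by
      simpa using (hasDerivAt_id t).mul_const ⟪gradient f x, u⟫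
    have hquad : HasDerivAt (fun t : ℝ => L / 2 * ‖u‖ ^ 2 * t ^ 2) (L * ‖u‖ ^ 2 * t) t := by
      refine ((hasDerivAt_pow 2 t).const_mul (L / 2 * ‖u‖ ^ 2)).congr_deriv ?_
      norm_num
      ring
    exact (hcomp.sub hlin).sub hquad
  have hanti : AntitoneOn ψ (Set.Icc 0 1) := by
    refine antitoneOn_of_hasDerivWithinAt_nonpos (convex_Icc 0 1)
      (fun t _ => (hψ t).continuousAt.continuousWithinAt)
      (fun t _ => (hψ t).hasDerivWithinAt) fun t ht => ?_
    rw [interior_Icc] at ht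
    have hgrad := hlip (x + t • u) x
    rw [add_sub_cancel_left, norm_smul, Real.norm_of_nonneg ht.1.le] at hgrad
    have hinner := real_inner_le_norm (gradient f (x + t • u) - gradient f x) u
    rw [inner_sub_left] at hinner
    nlinarith [mul_le_mul_of_nonneg_right hgrad (norm_nonneg u)]
  have h01 := hanti (Set.left_mem_Icc.2 zero_le_one) (Set.right_mem_Icc.2 zero_le_one) zero_le_one
  simp only [ψ, zero_smul, one_smul, add_zero] at h01
  linarith

/-- The lower counterpart of the descent lemma. -/
theorem descent_lemma_lower {f : E → ℝ} {L : ℝ} (hf : Differentiable ℝ f)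
    (hlip : ∀ u v : E, ‖gradient f u - gradient f v‖ ≤ L * ‖u - v‖) (x u : E) :
    f x + ⟪gradient f x, u⟫ - L / 2 * ‖u‖ ^ 2 ≤ f (x + u) := by
  have hgrad (y : E) : gradient (fun z => -f z) y = -gradient f y := by
    simp [gradient, fderiv_fun_neg]
  have h := descent_lemma (f := fun z => -f z) (L := L) hf.neg
    (fun v w => by
      rw [hgrad, hgrad, neg_sub_neg, norm_sub_rev]
      exact hlip v w) x u
  rw [hgrad, inner_neg_left] at h
  linarith

/-- The error of the central difference quotient in a direction `p`. -/
theorem abs_central_difference_sub_le {f : E → ℝ} {L : ℝ} (hf : Differentiable ℝ f)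
    (hlip : ∀ u v : E, ‖gradient f u - gradient f v‖ ≤ L * ‖u - v‖) (x p : E)
    {ε : ℝ} (hε : 0 < ε) :
    |⟪gradient f x, p⟫ - (f (x + ε • p) - f (x - ε • p)) / (2 * ε)| ≤ L * ε / 2 * ‖p‖ ^ 2 := by
  have h₁ := descent_lemma hf hlip x (ε • p)
  have h₂ := descent_lemma hf hlip x (-(ε • p))
  have h₃ := descent_lemma_lower hf hlip x (ε • p)
  have h₄ := descent_lemma_lower hf hlip x (-(ε • p))
  simp only [← sub_eq_add_neg, inner_neg_right, norm_neg, inner_smul_right, norm_smul,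
    Real.norm_of_nonneg hε.le] at h₁ h₂ h₃ h₄
  have hquot : (f (x + ε • p) - f (x - ε • p)) / (2 * ε) * (2 * ε) =
      f (x + ε • p) - f (x - ε • p) := div_mul_cancel₀ _ (by positivity)
  rw [abs_le]
  constructor <;> refine le_of_mul_le_mul_right ?_ (show 0 < 2 * ε by positivity) <;> nlinarith

end DescentLemma

/-- A symmetric operator `T` with `0 ⪯ T ⪯ M` satisfies `T² ⪯ M T`. -/
theorem LinearMap.IsSymmetric.norm_sq_apply_le {E : Type*} [NormedAddCommGroup E]
    [InnerProductSpace ℝ E] {T : E →ₗ[ℝ] E} (hT : T.IsSymmetric) {M : ℝ} (hM : 0 < M)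
    (hnonneg : ∀ v, 0 ≤ ⟪v, T v⟫) (hle : ∀ v, ⟪v, T v⟫ ≤ M * ‖v‖ ^ 2) (v : E) :
    ‖T v‖ ^ 2 ≤ M * ⟪v, T v⟫ := by
  have h := hnonneg (M • v - T v)
  have hsymm : ⟪v, T (T v)⟫ = ‖T v‖ ^ 2 := by
    rw [← hT v (T v), real_inner_self_eq_norm_sq]
  simp only [map_sub, map_smul, inner_sub_left, inner_sub_right, inner_smul_left,
    inner_smul_right, real_inner_self_eq_norm_sq, hsymm, RCLike.conj_to_real] at h
  refine le_of_mul_le_mul_left ?_ hM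
  nlinarith [hle (T v)]

theorem EuclideanSpace.sum_abs_sq_le {m : ℕ} (d : EuclideanSpace ℝ (Fin m)) :
    (∑ i, |d i|) ^ 2 ≤ m * ‖d‖ ^ 2 := by
  have h := sq_sum_le_card_mul_sum_sq (s := Finset.univ) (f := fun i => |d i|)
  simpa [EuclideanSpace.real_norm_sq_eq] using h

theorem Matrix.toEuclideanLin_eq_sum {n m : ℕ} (P : Matrix (Fin n) (Fin m) ℝ)
    (d : EuclideanSpace ℝ (Fin m)) :
    Matrix.toEuclideanLin P d =
      ∑ i, d i • Matrix.toEuclideanLin P (EuclideanSpace.single i (1 : ℝ)) := by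
  conv_lhs => rw [← (EuclideanSpace.basisFun (Fin m) ℝ).sum_repr d]
  simp

theorem Matrix.PosSemidef.inner_toEuclideanLin_nonneg {m : ℕ} {A : Matrix (Fin m) (Fin m) ℝ}
    (hA : A.PosSemidef) (v : EuclideanSpace ℝ (Fin m)) :
    0 ≤ ⟪v, Matrix.toEuclideanLin A v⟫ := by
  have h := hA.dotProduct_mulVec_nonneg v.ofLp
  simpa [EuclideanSpace.inner_eq_star_dotProduct, dotProduct_comm] using h

/-- For `f` continuously differentiable with `L`-Lipschitz gradient, `P` with columns of norm at
most 1, `M₁ I ⪯ H ⪯ M₂ I` symmetric (`0 < M₁ ≤ M₂`), `c ∈ (0,1/2)`, `g̃ = ∇_{P,ε}f(x)`,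
`d = -H g̃` with `‖g̃‖ ≥ 2 m² L (M₂/(M₁ c)) ε`: every step size `0 < α ≤ 2(1-2c)/(m M₂ L)`
satisfies the approximate Armijo condition `f(x + αPd) ≤ f(x) + cα g̃ᵀ d`. -/
theorem stmt15 {n m : ℕ} (f : EuclideanSpace ℝ (Fin n) → ℝ)
    (L : ℝ) (hL : 0 < L) (hf : ContDiff ℝ 1 f)
    (hlip : ∀ u v : EuclideanSpace ℝ (Fin n),
      ‖gradient f u - gradient f v‖ ≤ L * ‖u - v‖)
    (P : Matrix (Fin n) (Fin m) ℝ)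
    (hcol : ∀ j : Fin m, ‖Matrix.toEuclideanLin P (EuclideanSpace.single j (1 : ℝ))‖ ≤ 1)
    (H : Matrix (Fin m) (Fin m) ℝ) (hH : H.IsHermitian)
    (M₁ M₂ : ℝ) (hM₁ : 0 < M₁) (hM₁₂ : M₁ ≤ M₂)
    (hHge : (H - M₁ • (1 : Matrix (Fin m) (Fin m) ℝ)).PosSemidef)
    (hHle : (M₂ • (1 : Matrix (Fin m) (Fin m) ℝ) - H).PosSemidef)
    (c : ℝ) (hc : c ∈ Set.Ioo (0 : ℝ) (1 / 2))
    (ε : ℝ) (hε : 0 < ε) (x : EuclideanSpace ℝ (Fin n))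
    (d : EuclideanSpace ℝ (Fin m))
    (hd : d = -(Matrix.toEuclideanLin H (fdGrad f P ε x)))
    (hbig : 2 * (m : ℝ) ^ 2 * L * (M₂ / (M₁ * c)) * ε ≤ ‖fdGrad f P ε x‖) :
    ∀ α : ℝ, 0 < α → α ≤ 2 * (1 - 2 * c) / ((m : ℝ) * M₂ * L) →
      f (x + α • Matrix.toEuclideanLin P d) ≤
        f x + c * α * ⟪fdGrad f P ε x, d⟫ := by
  intro α hα hαle
  obtain ⟨hc₀, hc₁⟩ := hc
  have hM₂ : 0 < M₂ := hM₁.trans_le hM₁₂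
  have hm : (1 : ℝ) ≤ m := by
    rcases Nat.eq_zero_or_pos m with rfl | hm
    · simp at hαle
      linarith
    · exact_mod_cast hm
  have hdiff : Differentiable ℝ f := hf.differentiable one_ne_zero
  set g := fdGrad f P ε x
  set T := Matrix.toEuclideanLin H
  have hsymm : T.IsSymmetric := Matrix.isSymmetric_toEuclideanLin_iff.2 hH
  have hge (v : EuclideanSpace ℝ (Fin m)) : M₁ * ‖v‖ ^ 2 ≤ ⟪v, T v⟫ := by
    have h := hHge.inner_toEuclideanLin_nonneg v
    simpa [inner_sub_right, inner_smul_right] using h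
  have hle (v : EuclideanSpace ℝ (Fin m)) : ⟪v, T v⟫ ≤ M₂ * ‖v‖ ^ 2 := by
    have h := hHle.inner_toEuclideanLin_nonneg v
    simpa [inner_sub_right, inner_smul_right] using h
  set s := ⟪g, T g⟫
  have hgd : ⟪g, d⟫ = -s := by rw [hd, inner_neg_right]
  have hs₁ : M₁ * ‖g‖ ^ 2 ≤ s := hge g
  have hd₁ : ‖d‖ ^ 2 ≤ M₂ * s := by
    rw [hd, norm_neg]
    exact hsymm.norm_sq_apply_le hM₂
      (fun v => (by positivity : 0 ≤ M₁ * ‖v‖ ^ 2).trans (hge v)) hle g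
  have hd₂ : ‖d‖ ≤ M₂ * ‖g‖ := by
    refine abs_le_of_sq_le_sq' ?_ (by positivity) |>.2
    calc ‖d‖ ^ 2 ≤ M₂ * s := hd₁
      _ ≤ M₂ * (M₂ * ‖g‖ ^ 2) := by gcongr; exact hle g
      _ = (M₂ * ‖g‖) ^ 2 := by ring
  set S := ∑ i, |d i| with hS
  have hS₀ : 0 ≤ S := Finset.sum_nonneg fun i _ => abs_nonneg _
  have hS₁ : S ^ 2 ≤ m * ‖d‖ ^ 2 := EuclideanSpace.sum_abs_sq_le d
  have hS₂ : S ≤ m * ‖d‖ := by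
    refine abs_le_of_sq_le_sq' ?_ (by positivity) |>.2
    calc S ^ 2 ≤ m * ‖d‖ ^ 2 := hS₁
      _ ≤ (m : ℝ) ^ 2 * ‖d‖ ^ 2 := by gcongr; nlinarith
      _ = (m * ‖d‖) ^ 2 := by ring
  have hPd : ‖Matrix.toEuclideanLin P d‖ ≤ S := by
    rw [Matrix.toEuclideanLin_eq_sum]
    refine norm_sum_le_of_le _ fun i _ => ?_
    rw [norm_smul, Real.norm_eq_abs]
    exact mul_le_of_le_one_right (abs_nonneg _) (hcol i)
  have hslope : ⟪gradient f x, Matrix.toEuclideanLin P d⟫ ≤ -s + L * ε / 2 * S := by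
    rw [← hgd, ← sub_le_iff_le_add', Matrix.toEuclideanLin_eq_sum, inner_sum, PiLp.inner_apply,
      ← Finset.sum_sub_distrib, hS, Finset.mul_sum]
    refine Finset.sum_le_sum fun i _ => ?_
    have herr := abs_central_difference_sub_le hdiff hlip x
      (Matrix.toEuclideanLin P (EuclideanSpace.single i (1 : ℝ))) hε
    have hgi : g i = (f (x + ε • Matrix.toEuclideanLin P (EuclideanSpace.single i (1 : ℝ))) -
      f (x - ε • Matrix.toEuclideanLin P (EuclideanSpace.single i (1 : ℝ)))) / (2 * ε) := rfl
    rw [← hgi] at herr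
    have hbound := herr.trans (mul_le_of_le_one_right (by positivity)
      (pow_le_one₀ (norm_nonneg _) (hcol i)))
    rw [inner_smul_right, show ⟪g i, d i⟫ = d i * g i from rfl, ← mul_sub]
    calc _ ≤ |d i| * _ := (le_abs_self _).trans_eq (abs_mul _ _)
      _ ≤ |d i| * (L * ε / 2) := by gcongr
      _ = _ := mul_comm _ _
  have herror : L * ε / 2 * S ≤ c * s := by
    have hbig' : 2 * (m : ℝ) ^ 2 * L * M₂ * ε ≤ M₁ * c * ‖g‖ := by
      calc _ = M₁ * c * (2 * (m : ℝ) ^ 2 * L * (M₂ / (M₁ * c)) * ε) := by field_simp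
        _ ≤ _ := by gcongr
    calc L * ε / 2 * S ≤ L * ε / 2 * (m * (M₂ * ‖g‖)) := by
          gcongr
          exact hS₂.trans (by gcongr)
      _ = (m * L * M₂ * ε / 2) * ‖g‖ := by ring
      _ ≤ (2 * (m : ℝ) ^ 2 * L * M₂ * ε) * ‖g‖ := by
          gcongr
          have hpos : 0 < L * M₂ * ε := by positivity
          have hsq : (m : ℝ) / 2 ≤ 2 * (m : ℝ) ^ 2 := by nlinarith
          linarith [mul_le_mul_of_nonneg_right hsq hpos.le]
      _ ≤ (M₁ * c * ‖g‖) * ‖g‖ := by gcongr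
      _ = c * (M₁ * ‖g‖ ^ 2) := by ring
      _ ≤ c * s := by gcongr
  have hstep : L / 2 * α * (m * M₂) ≤ 1 - 2 * c := by
    rw [le_div_iff₀ (by positivity)] at hαle
    linarith
  have hs₀ : 0 ≤ s := (by positivity : 0 ≤ M₁ * ‖g‖ ^ 2).trans hs₁
  have hquad : L / 2 * α * ‖Matrix.toEuclideanLin P d‖ ^ 2 ≤ (1 - 2 * c) * s := by
    calc _ ≤ L / 2 * α * (m * (M₂ * s)) := by
          gcongr
          calc _ ≤ S ^ 2 := by gcongr
            _ ≤ m * ‖d‖ ^ 2 := hS₁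
            _ ≤ _ := by gcongr
      _ = L / 2 * α * (m * M₂) * s := by ring
      _ ≤ _ := by gcongr
  have hdesc := descent_lemma hdiff hlip x (α • Matrix.toEuclideanLin P d)
  rw [inner_smul_right, norm_smul, Real.norm_of_nonneg hα.le] at hdesc
  rw [hgd]
  have hsum : ⟪gradient f x, Matrix.toEuclideanLin P d⟫ +
      L / 2 * α * ‖Matrix.toEuclideanLin P d‖ ^ 2 ≤ -(c * s) := by linarith
  linarith [mul_le_mul_of_nonneg_left hsum hα.le]
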